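/- Suppose u, v : Ω → ℝ are C³ functions on an open set Ω ⊆ ℝ² satisfying the lightcone wave map system u_{xy} = u_x u_y/(u+v), v_{xy} = v_x v_y/(u+v), with u + v nowhere zero on Ω and ∂u/∂x nowhere zero on Ω. Then the two functions α₁ = (∂u/∂x)(∂v/∂x)/(u+v) and α₃ = (∂²u/∂x²)/(∂u/∂x) − (∂v/∂x)/(u+v) have identically vanishing partial derivative with respect to y on Ω; that is, α₁ and α₃ are first integrals of the y-characteristic system of the lightcone wave map system. -/

import Mathlib

/-- Partial derivative with respect to the first variable `x`. -/
noncomputable def pdx (f : ℝ × ℝ → ℝ) (p : ℝ × ℝ) : ℝ :=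
  deriv (fun x => f (x, p.2)) p.1

/-- Partial derivative with respect to the second variable `y`. -/
noncomputable def pdy (f : ℝ × ℝ → ℝ) (p : ℝ × ℝ) : ℝ :=
  deriv (fun y => f (p.1, y)) p.2

open Filter Topology

theorem DifferentiableAt.hasDerivAt_pdx {f : ℝ × ℝ → ℝ} {p : ℝ × ℝ}
    (hf : DifferentiableAt ℝ f p) :
    HasDerivAt (fun x => f (x, p.2)) (pdx f p) p.1 := by
  have h : DifferentiableAt ℝ (fun x => f (x, p.2)) p.1 :=
    DifferentiableAt.comp (f := fun x : ℝ => (x, p.2)) p.1 hf (by fun_prop)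
  exact h.hasDerivAt

theorem DifferentiableAt.hasDerivAt_pdy {f : ℝ × ℝ → ℝ} {p : ℝ × ℝ}
    (hf : DifferentiableAt ℝ f p) :
    HasDerivAt (fun y => f (p.1, y)) (pdy f p) p.2 := by
  have h : DifferentiableAt ℝ (fun y => f (p.1, y)) p.2 :=
    DifferentiableAt.comp (f := fun y : ℝ => (p.1, y)) p.2 hf (by fun_prop)
  exact h.hasDerivAt

theorem DifferentiableAt.pdx_eq_fderiv {f : ℝ × ℝ → ℝ} {p : ℝ × ℝ}
    (hf : DifferentiableAt ℝ f p) : pdx f p = fderiv ℝ f p (1, 0) :=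
  (HasFDerivAt.comp_hasDerivAt (f := fun x : ℝ => (x, p.2)) p.1 hf.hasFDerivAt
    ((hasDerivAt_id p.1).prodMk (hasDerivAt_const p.1 p.2))).deriv

theorem DifferentiableAt.pdy_eq_fderiv {f : ℝ × ℝ → ℝ} {p : ℝ × ℝ}
    (hf : DifferentiableAt ℝ f p) : pdy f p = fderiv ℝ f p (0, 1) :=
  (HasFDerivAt.comp_hasDerivAt (f := fun y : ℝ => (p.1, y)) p.2 hf.hasFDerivAt
    ((hasDerivAt_const p.2 p.1).prodMk (hasDerivAt_id p.2))).deriv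

theorem Filter.EventuallyEq.pdx_eq {f g : ℝ × ℝ → ℝ} {p : ℝ × ℝ} (h : f =ᶠ[𝓝 p] g) :
    pdx f p = pdx g p := by
  have hc : Tendsto (fun x : ℝ => (x, p.2)) (𝓝 p.1) (𝓝 p) :=
    (by fun_prop : Continuous fun x : ℝ => (x, p.2)).tendsto p.1
  exact EventuallyEq.deriv_eq (hc.eventually h)

theorem Filter.EventuallyEq.pdy_eq {f g : ℝ × ℝ → ℝ} {p : ℝ × ℝ} (h : f =ᶠ[𝓝 p] g) :
    pdy f p = pdy g p := by
  have hc : Tendsto (fun y : ℝ => (p.1, y)) (𝓝 p.2) (𝓝 p) :=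
    (by fun_prop : Continuous fun y : ℝ => (p.1, y)).tendsto p.2
  exact EventuallyEq.deriv_eq (hc.eventually h)

theorem ContDiffOn.pdx_of_isOpen {f : ℝ × ℝ → ℝ} {Ω : Set (ℝ × ℝ)} {m n : WithTop ℕ∞}
    (hf : ContDiffOn ℝ n f Ω) (hΩ : IsOpen Ω) (hmn : m + 1 ≤ n) :
    ContDiffOn ℝ m (pdx f) Ω := by
  have hn : n ≠ 0 := by
    rintro rfl
    simp at hmn
  exact ((hf.fderiv_of_isOpen hΩ hmn).clm_apply contDiffOn_const).congr fun p hp =>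
    ((hf.differentiableOn hn).differentiableAt (hΩ.mem_nhds hp)).pdx_eq_fderiv

theorem ContDiffAt.pdx_pdy_comm {f : ℝ × ℝ → ℝ} {p : ℝ × ℝ} (hf : ContDiffAt ℝ 2 f p) :
    pdx (pdy f) p = pdy (pdx f) p := by
  have hdiff : ∀ᶠ q in 𝓝 p, DifferentiableAt ℝ f q :=
    (hf.eventually (by simp)).mono fun q hq => hq.differentiableAt (by simp)
  have hx : pdx f =ᶠ[𝓝 p] fun q => fderiv ℝ f q (1, 0) :=
    hdiff.mono fun q hq => hq.pdx_eq_fderiv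
  have hy : pdy f =ᶠ[𝓝 p] fun q => fderiv ℝ f q (0, 1) :=
    hdiff.mono fun q hq => hq.pdy_eq_fderiv
  have hd : DifferentiableAt ℝ (fderiv ℝ f) p :=
    (hf.fderiv_right (m := 1) (by norm_num)).differentiableAt (by simp)
  have happ (w : ℝ × ℝ) : HasFDerivAt (fun q => fderiv ℝ f q w)
      ((fderiv ℝ (fderiv ℝ f) p).flip w) p := by
    simpa using hd.hasFDerivAt.clm_apply (hasFDerivAt_const w p)
  rw [hy.pdx_eq, hx.pdy_eq, (happ _).differentiableAt.pdx_eq_fderiv,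
    (happ _).differentiableAt.pdy_eq_fderiv, (happ _).fderiv, (happ _).fderiv]
  exact (hf.isSymmSndFDerivAt (by simp)) _ _

/-- for a C³ solution of the lightcone wave map system with `u+v` and `u_x`
nowhere zero, the functions `α₁ = u_x v_x/(u+v)` and `α₃ = u_{xx}/u_x − v_x/(u+v)` are
first integrals of the `y`-characteristic system: their `y`-partial derivatives vanish. -/
theorem firstIntegrals_y_characteristics
    (Ω : Set (ℝ × ℝ)) (hΩ : IsOpen Ω) (u v : ℝ × ℝ → ℝ)
    (hu : ContDiffOn ℝ 3 u Ω) (hv : ContDiffOn ℝ 3 v Ω)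
    (hsum : ∀ p ∈ Ω, u p + v p ≠ 0)
    (hux : ∀ p ∈ Ω, pdx u p ≠ 0)
    (hueq : ∀ p ∈ Ω, pdy (pdx u) p = pdx u p * pdy u p / (u p + v p))
    (hveq : ∀ p ∈ Ω, pdy (pdx v) p = pdx v p * pdy v p / (u p + v p)) :
    (∀ p ∈ Ω, pdy (fun q => pdx u q * pdx v q / (u q + v q)) p = 0) ∧
    (∀ p ∈ Ω, pdy (fun q => pdx (pdx u) q / pdx u q - pdx v q / (u q + v q)) p = 0) := by
  have hux2 : ContDiffOn ℝ 2 (pdx u) Ω := hu.pdx_of_isOpen hΩ (by norm_num)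
  have hvx2 : ContDiffOn ℝ 2 (pdx v) Ω := hv.pdx_of_isOpen hΩ (by norm_num)
  have huxx1 : ContDiffOn ℝ 1 (pdx (pdx u)) Ω := hux2.pdx_of_isOpen hΩ (by norm_num)
  have diffAt {f : ℝ × ℝ → ℝ} {n : WithTop ℕ∞} (hf : ContDiffOn ℝ n f Ω) (hn : n ≠ 0)
      {p : ℝ × ℝ} (hp : p ∈ Ω) : DifferentiableAt ℝ f p :=
    (hf.differentiableOn hn).differentiableAt (hΩ.mem_nhds hp)
  refine ⟨fun p hp => ?_, fun p hp => ?_⟩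
  · have hs := hsum p hp
    have du := (diffAt hu (by simp) hp).hasDerivAt_pdy
    have dv := (diffAt hv (by simp) hp).hasDerivAt_pdy
    have dux := (diffAt hux2 (by simp) hp).hasDerivAt_pdy
    have dvx := (diffAt hvx2 (by simp) hp).hasDerivAt_pdy
    refine ((dux.fun_mul dvx).fun_div (du.fun_add dv) hs).deriv.trans ?_
    rw [hueq p hp, hveq p hp]
    field_simp
    ring
  · have hs := hsum p hp
    have hx := hux p hp
    have hΩp := hΩ.mem_nhds hp
    have du := (diffAt hu (by simp) hp).hasDerivAt_pdy
    have dv := (diffAt hv (by simp) hp).hasDerivAt_pdy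
    have dux := (diffAt hux2 (by simp) hp).hasDerivAt_pdy
    have dvx := (diffAt hvx2 (by simp) hp).hasDerivAt_pdy
    have duxx := (diffAt huxx1 (by simp) hp).hasDerivAt_pdy
    have hu2 : ContDiffAt ℝ 2 u p := (hu.contDiffAt hΩp).of_le (by norm_num)
    have huyx : HasDerivAt (fun x => pdy u (x, p.2)) (pdx (pdy u) p) p.1 := by
      have hfd : DifferentiableAt ℝ (fun q => fderiv ℝ u q (0, 1)) p :=
        ((hu2.fderiv_right (m := 1) (by norm_num)).differentiableAt (by simp)).clm_apply
          (differentiableAt_const _)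
      refine (hfd.congr_of_eventuallyEq ?_).hasDerivAt_pdx
      filter_upwards [hΩp] with q hq using (diffAt hu (by simp) hq).pdy_eq_fderiv
    have huxxy : pdy (pdx (pdx u)) p =
        pdx (fun q => pdx u q * pdy u q / (u q + v q)) p := by
      rw [← (hux2.contDiffAt hΩp).pdx_pdy_comm]
      refine EventuallyEq.pdx_eq ?_
      filter_upwards [hΩp] with q hq using hueq q hq
    have hrhs := ((((diffAt hux2 (by simp) hp).hasDerivAt_pdx).fun_mul huyx).fun_div
      ((diffAt hu (by simp) hp).hasDerivAt_pdx.fun_add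
        (diffAt hv (by simp) hp).hasDerivAt_pdx) hs).deriv
    replace huxxy := huxxy.trans hrhs
    rw [hu2.pdx_pdy_comm, hueq p hp] at huxxy
    refine ((duxx.fun_div dux hx).fun_sub (dvx.fun_div (du.fun_add dv) hs)).deriv.trans ?_
    rw [huxxy, hueq p hp, hveq p hp]
    simp only [Prod.mk.eta]
    field_simp
    ring
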